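/- Fix x > 0 with f̂(x) := ln(x/K) + R_d − R_f ≠ 0. Then each of the four third-order partial derivatives ∂_{xxx} Put_BS(x,y), ∂_{xxy} Put_BS(x,y), ∂_{xyy} Put_BS(x,y), ∂_{yyy} Put_BS(x,y) tends to 0 as y → 0⁺ and also as y → ∞. -/

import Mathlib

open Real MeasureTheory Filter

/-- The standard normal cumulative distribution function Φ. -/
noncomputable def stdNormalCDF (x : ℝ) : ℝ :=
  ∫ t in Set.Iic x, (Real.sqrt (2 * Real.pi))⁻¹ * Real.exp (-t ^ 2 / 2)

/-- The standard normal density φ(z) = (2π)^{−1/2} e^{−z²/2}. -/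
noncomputable def stdNormalPDF (z : ℝ) : ℝ :=
  (Real.sqrt (2 * Real.pi))⁻¹ * Real.exp (-z ^ 2 / 2)

/-- d₊(x,y) = (ln(x/K) + R_d − R_f)/√y + √y/2. -/
noncomputable def dplus (K Rd Rf x y : ℝ) : ℝ :=
  (Real.log (x / K) + Rd - Rf) / Real.sqrt y + Real.sqrt y / 2

/-- d₋(x,y) = (ln(x/K) + R_d − R_f)/√y − √y/2. -/
noncomputable def dminus (K Rd Rf x y : ℝ) : ℝ :=
  (Real.log (x / K) + Rd - Rf) / Real.sqrt y - Real.sqrt y / 2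

/-- The Black–Scholes put value Put_BS(x,y). -/
noncomputable def PutBS (K Rd Rf x y : ℝ) : ℝ :=
  K * Real.exp (-Rd) * stdNormalCDF (-(dminus K Rd Rf x y))
    - x * Real.exp (-Rf) * stdNormalCDF (-(dplus K Rd Rf x y))

/-- ∂₃Put_BS/∂x³. -/
noncomputable def Pxxx (K Rd Rf x y : ℝ) : ℝ :=
  iteratedDeriv 3 (fun x' => PutBS K Rd Rf x' y) x

/-- ∂₃Put_BS/∂x²∂y. -/
noncomputable def Pxxy (K Rd Rf x y : ℝ) : ℝ :=
  deriv (fun y' => iteratedDeriv 2 (fun x' => PutBS K Rd Rf x' y') x) y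

/-- ∂₃Put_BS/∂x∂y². -/
noncomputable def Pxyy (K Rd Rf x y : ℝ) : ℝ :=
  deriv (fun x' => iteratedDeriv 2 (fun y' => PutBS K Rd Rf x' y') y) x

/-- ∂₃Put_BS/∂y³. -/
noncomputable def Pyyy (K Rd Rf x y : ℝ) : ℝ :=
  iteratedDeriv 3 (fun y' => PutBS K Rd Rf x y') y

/-- The log-forward moneyness `ln (x / K) + R_d − R_f`. -/
noncomputable def fhat (K Rd Rf x : ℝ) : ℝ := Real.log (x / K) + Rd - Rf

/-- The discounted density `e^{−R_f} φ(d₊(x,y)) / √y`. -/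
noncomputable def scaledDensity (K Rd Rf x y : ℝ) : ℝ :=
  Real.exp (-Rf) * stdNormalPDF (dplus K Rd Rf x y) / Real.sqrt y

/-- The logarithmic derivative in `y` of `scaledDensity`. -/
noncomputable def logDerivY (K Rd Rf x y : ℝ) : ℝ :=
  fhat K Rd Rf x ^ 2 / 2 * y⁻¹ ^ 2 - 1 / 2 * y⁻¹ - 1 / 8

lemma stdNormalPDF_neg (z : ℝ) : stdNormalPDF (-z) = stdNormalPDF z := by
  simp [stdNormalPDF]

lemma continuous_stdNormalPDF : Continuous stdNormalPDF := by
  unfold stdNormalPDF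
  fun_prop

lemma integrable_stdNormalPDF : Integrable stdNormalPDF := by
  refine ((integrable_exp_neg_mul_sq (b := 1 / 2) (by norm_num)).const_mul
    (Real.sqrt (2 * Real.pi))⁻¹).congr (Eventually.of_forall fun t => ?_)
  simp only [stdNormalPDF]
  congr 2
  ring

lemma hasDerivAt_stdNormalCDF (z : ℝ) : HasDerivAt stdNormalCDF (stdNormalPDF z) z := by
  have heq : stdNormalCDF = fun u => stdNormalCDF 0 + ∫ t in (0 : ℝ)..u, stdNormalPDF t := by
    funext u
    have h := intervalIntegral.integral_Iic_sub_Iic (a := (0 : ℝ)) (b := u)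
      integrable_stdNormalPDF.integrableOn integrable_stdNormalPDF.integrableOn
    rw [← h]
    simp only [stdNormalCDF, stdNormalPDF]
    ring
  rw [heq]
  exact (intervalIntegral.integral_hasDerivAt_right
    (continuous_stdNormalPDF.intervalIntegrable _ _)
    (continuous_stdNormalPDF.stronglyMeasurableAtFilter _ _)
    continuous_stdNormalPDF.continuousAt).const_add _

lemma hasDerivAt_stdNormalPDF (z : ℝ) : HasDerivAt stdNormalPDF (-z * stdNormalPDF z) z := by
  have h : HasDerivAt (fun u : ℝ => -u ^ 2 / 2) (-z) z := by
    refine (((hasDerivAt_pow 2 z).neg).div_const 2).congr_deriv ?_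
    ring
  refine (h.exp.const_mul (Real.sqrt (2 * Real.pi))⁻¹).congr_deriv ?_
  simp only [stdNormalPDF]
  ring

section

variable {K Rd Rf x y : ℝ}

lemma hasDerivAt_fhat (hK : 0 < K) (hx : 0 < x) :
    HasDerivAt (fun u => fhat K Rd Rf u) x⁻¹ x := by
  have h : HasDerivAt (fun u => u / K) (1 / K) x := (hasDerivAt_id x).div_const K
  refine (((h.log (by positivity)).add_const Rd).sub_const Rf).congr_deriv ?_
  field_simp

lemma hasDerivAt_dplus_fst (hK : 0 < K) (hx : 0 < x) :
    HasDerivAt (fun u => dplus K Rd Rf u y) (x⁻¹ / √y) x :=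
  ((hasDerivAt_fhat hK hx).div_const _).add_const _

lemma hasDerivAt_dminus_fst (hK : 0 < K) (hx : 0 < x) :
    HasDerivAt (fun u => dminus K Rd Rf u y) (x⁻¹ / √y) x :=
  ((hasDerivAt_fhat hK hx).div_const _).sub_const _

lemma hasDerivAt_dplus_snd (hy : 0 < y) :
    HasDerivAt (fun v => dplus K Rd Rf x v)
      (-fhat K Rd Rf x / (2 * y * √y) + 1 / (4 * √y)) y := by
  have h := Real.hasDerivAt_sqrt hy.ne'
  have hs : √y ≠ 0 := (Real.sqrt_pos.2 hy).ne'
  refine (((hasDerivAt_const y (fhat K Rd Rf x)).div h hs).add (h.div_const 2)).congr_deriv ?_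
  rw [Real.sq_sqrt hy.le]
  field_simp
  ring

lemma hasDerivAt_dminus_snd (hy : 0 < y) :
    HasDerivAt (fun v => dminus K Rd Rf x v)
      (-fhat K Rd Rf x / (2 * y * √y) - 1 / (4 * √y)) y := by
  have h := Real.hasDerivAt_sqrt hy.ne'
  have hs : √y ≠ 0 := (Real.sqrt_pos.2 hy).ne'
  refine (((hasDerivAt_const y (fhat K Rd Rf x)).div h hs).sub (h.div_const 2)).congr_deriv ?_
  rw [Real.sq_sqrt hy.le]
  field_simp
  ring

lemma dplus_sq (hy : 0 < y) :
    dplus K Rd Rf x y ^ 2 = fhat K Rd Rf x ^ 2 * y⁻¹ + fhat K Rd Rf x + y / 4 := by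
  obtain ⟨s, hs, rfl⟩ : ∃ s : ℝ, 0 < s ∧ y = s ^ 2 :=
    ⟨√y, Real.sqrt_pos.2 hy, (Real.sq_sqrt hy.le).symm⟩
  simp only [dplus, fhat, Real.sqrt_sq hs.le]
  field_simp
  ring

lemma dminus_sq (hy : 0 < y) :
    dminus K Rd Rf x y ^ 2 = dplus K Rd Rf x y ^ 2 - 2 * fhat K Rd Rf x := by
  have hs : √y ≠ 0 := (Real.sqrt_pos.2 hy).ne'
  simp only [dplus, dminus, fhat]
  field_simp
  ring

/-- The identity behind the Black–Scholes Greeks: `K e^{−R_d} φ(d₋) = x e^{−R_f} φ(d₊)`. -/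
lemma strike_mul_pdf_dminus (hK : 0 < K) (hx : 0 < x) (hy : 0 < y) :
    K * Real.exp (-Rd) * stdNormalPDF (dminus K Rd Rf x y)
      = x * Real.exp (-Rf) * stdNormalPDF (dplus K Rd Rf x y) := by
  have hxK : x = K * Real.exp (Real.log (x / K)) := by
    rw [Real.exp_log (by positivity)]
    field_simp
  have hexp : Real.exp (-Rd) * Real.exp (-dminus K Rd Rf x y ^ 2 / 2)
      = Real.exp (Real.log (x / K)) * Real.exp (-Rf) * Real.exp (-dplus K Rd Rf x y ^ 2 / 2) := by
    rw [← Real.exp_add, ← Real.exp_add, ← Real.exp_add, dminus_sq hy]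
    simp only [fhat]
    congr 1
    ring
  simp only [stdNormalPDF]
  calc _ = K * (√(2 * π))⁻¹ *
        (Real.exp (-Rd) * Real.exp (-dminus K Rd Rf x y ^ 2 / 2)) := by ring
    _ = K * Real.exp (Real.log (x / K)) * Real.exp (-Rf) *
        ((√(2 * π))⁻¹ * Real.exp (-dplus K Rd Rf x y ^ 2 / 2)) := by rw [hexp]; ring
    _ = _ := by rw [← hxK]

lemma hasDerivAt_scaledDensity_fst (hK : 0 < K) (hx : 0 < x) (hy : 0 < y) :
    HasDerivAt (fun u => scaledDensity K Rd Rf u y)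
      (-scaledDensity K Rd Rf x y * (fhat K Rd Rf x * y⁻¹ + 1 / 2) / x) x := by
  refine ((((hasDerivAt_stdNormalPDF _).comp x (hasDerivAt_dplus_fst hK hx)).const_mul
    (Real.exp (-Rf))).div_const (√y)).congr_deriv ?_
  have hs : 0 < √y := Real.sqrt_pos.2 hy
  have hd : dplus K Rd Rf x y = √y * (fhat K Rd Rf x * y⁻¹ + 1 / 2) := by
    have h2 := Real.sq_sqrt hy.le
    simp only [dplus, fhat]
    field_simp
    rw [h2]
    ring
  rw [scaledDensity]
  generalize stdNormalPDF (dplus K Rd Rf x y) = p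
  rw [hd]
  field_simp

lemma hasDerivAt_scaledDensity_snd (hy : 0 < y) :
    HasDerivAt (fun v => scaledDensity K Rd Rf x v)
      (scaledDensity K Rd Rf x y * logDerivY K Rd Rf x y) y := by
  have hs : 0 < √y := Real.sqrt_pos.2 hy
  refine ((((hasDerivAt_stdNormalPDF _).comp y (hasDerivAt_dplus_snd hy)).const_mul
    (Real.exp (-Rf))).div (Real.hasDerivAt_sqrt hy.ne') hs.ne').congr_deriv ?_
  have hd : dplus K Rd Rf x y = fhat K Rd Rf x / √y + √y / 2 := rfl
  have h2 := Real.sq_sqrt hy.le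
  rw [scaledDensity, logDerivY]
  generalize fhat K Rd Rf x = f at *
  generalize hp : stdNormalPDF (dplus K Rd Rf x y) = p
  simp only [Function.comp, hp]
  rw [hd]
  generalize √y = s at *
  subst h2
  field_simp
  ring

lemma hasDerivAt_logDerivY_snd (hy : 0 < y) :
    HasDerivAt (fun v => logDerivY K Rd Rf x v)
      (-fhat K Rd Rf x ^ 2 * y⁻¹ ^ 3 + 1 / 2 * y⁻¹ ^ 2) y := by
  have h := hasDerivAt_inv hy.ne'
  refine ((((h.pow 2).const_mul (fhat K Rd Rf x ^ 2 / 2)).sub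
    (h.const_mul (1 / 2))).sub_const (1 / 8)).congr_deriv ?_
  norm_num
  field_simp

lemma hasDerivAt_logDerivY_fst (hK : 0 < K) (hx : 0 < x) :
    HasDerivAt (fun u => logDerivY K Rd Rf u y) (fhat K Rd Rf x * y⁻¹ ^ 2 / x) x := by
  refine ((((((hasDerivAt_fhat (Rd := Rd) (Rf := Rf) hK hx).pow 2).div_const 2).mul_const
    (y⁻¹ ^ 2)).sub_const (1 / 2 * y⁻¹)).sub_const (1 / 8)).congr_deriv ?_
  norm_num
  ring

lemma hasDerivAt_putBS_fst (hK : 0 < K) (hx : 0 < x) (hy : 0 < y) :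
    HasDerivAt (fun u => PutBS K Rd Rf u y)
      (-Real.exp (-Rf) * stdNormalCDF (-dplus K Rd Rf x y)) x := by
  have hm := ((hasDerivAt_stdNormalCDF _).comp x
    (hasDerivAt_dminus_fst (Rd := Rd) (Rf := Rf) (y := y) hK hx).neg).const_mul
      (K * Real.exp (-Rd))
  have hp := ((hasDerivAt_id x).mul_const (Real.exp (-Rf))).mul
    ((hasDerivAt_stdNormalCDF _).comp x
      (hasDerivAt_dplus_fst (Rd := Rd) (Rf := Rf) (y := y) hK hx).neg)
  refine (hm.sub hp).congr_deriv ?_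
  have hid := strike_mul_pdf_dminus (Rd := Rd) (Rf := Rf) hK hx hy
  simp only [Pi.neg_apply, stdNormalPDF_neg, Function.comp, id]
  linear_combination (-(x⁻¹ / √y)) * hid

lemma hasDerivAt_putBS_snd (hK : 0 < K) (hx : 0 < x) (hy : 0 < y) :
    HasDerivAt (fun v => PutBS K Rd Rf x v) (x / 2 * scaledDensity K Rd Rf x y) y := by
  have hm := ((hasDerivAt_stdNormalCDF _).comp y
    (hasDerivAt_dminus_snd (K := K) (Rd := Rd) (Rf := Rf) (x := x) hy).neg).const_mul
      (K * Real.exp (-Rd))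
  have hp := ((hasDerivAt_stdNormalCDF _).comp y
    (hasDerivAt_dplus_snd (K := K) (Rd := Rd) (Rf := Rf) (x := x) hy).neg).const_mul
      (x * Real.exp (-Rf))
  refine (hm.sub hp).congr_deriv ?_
  have hid := strike_mul_pdf_dminus (Rd := Rd) (Rf := Rf) hK hx hy
  simp only [Pi.neg_apply, stdNormalPDF_neg, scaledDensity]
  linear_combination (-(-fhat K Rd Rf x / (2 * y * √y) - 1 / (4 * √y))) * hid

lemma iteratedDeriv_two_putBS_fst (hK : 0 < K) (hx : 0 < x) (hy : 0 < y) :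
    iteratedDeriv 2 (fun u => PutBS K Rd Rf u y) x = scaledDensity K Rd Rf x y / x := by
  rw [iteratedDeriv_succ, iteratedDeriv_one]
  have h : deriv (fun u => PutBS K Rd Rf u y) =ᶠ[nhds x]
      fun u => -Real.exp (-Rf) * stdNormalCDF (-dplus K Rd Rf u y) := by
    filter_upwards [Ioi_mem_nhds hx] with u hu
    exact (hasDerivAt_putBS_fst hK hu hy).deriv
  rw [h.deriv_eq]
  refine (((hasDerivAt_stdNormalCDF _).comp x
    (hasDerivAt_dplus_fst hK hx).neg).const_mul (-Real.exp (-Rf))).deriv.trans ?_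
  simp only [Pi.neg_apply, stdNormalPDF_neg, scaledDensity]
  ring

lemma iteratedDeriv_two_putBS_snd (hK : 0 < K) (hx : 0 < x) (hy : 0 < y) :
    iteratedDeriv 2 (fun v => PutBS K Rd Rf x v) y
      = x / 2 * (scaledDensity K Rd Rf x y * logDerivY K Rd Rf x y) := by
  rw [iteratedDeriv_succ, iteratedDeriv_one]
  have h : deriv (fun v => PutBS K Rd Rf x v) =ᶠ[nhds y]
      fun v => x / 2 * scaledDensity K Rd Rf x v := by
    filter_upwards [Ioi_mem_nhds hy] with v hv
    exact (hasDerivAt_putBS_snd hK hx hv).deriv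
  rw [h.deriv_eq]
  exact ((hasDerivAt_scaledDensity_snd hy).const_mul (x / 2)).deriv

lemma Pxxx_eq (hK : 0 < K) (hx : 0 < x) (hy : 0 < y) :
    Pxxx K Rd Rf x y = scaledDensity K Rd Rf x y *
      (-(fhat K Rd Rf x * y⁻¹ + 3 / 2) / x ^ 2) := by
  rw [Pxxx, iteratedDeriv_succ]
  have h : iteratedDeriv 2 (fun u => PutBS K Rd Rf u y) =ᶠ[nhds x]
      fun u => scaledDensity K Rd Rf u y / u := by
    filter_upwards [Ioi_mem_nhds hx] with u hu
    exact iteratedDeriv_two_putBS_fst hK hu hy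
  rw [h.deriv_eq]
  refine ((hasDerivAt_scaledDensity_fst hK hx hy).div (hasDerivAt_id x) hx.ne').deriv.trans ?_
  simp only [id]
  field_simp
  ring

lemma Pxxy_eq (hK : 0 < K) (hx : 0 < x) (hy : 0 < y) :
    Pxxy K Rd Rf x y = scaledDensity K Rd Rf x y * (logDerivY K Rd Rf x y / x) := by
  have h : (fun v => iteratedDeriv 2 (fun u => PutBS K Rd Rf u v) x) =ᶠ[nhds y]
      fun v => scaledDensity K Rd Rf x v / x := by
    filter_upwards [Ioi_mem_nhds hy] with v hv
    exact iteratedDeriv_two_putBS_fst hK hx hv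
  rw [Pxxy, h.deriv_eq]
  refine ((hasDerivAt_scaledDensity_snd hy).div_const x).deriv.trans ?_
  ring

lemma Pxyy_eq (hK : 0 < K) (hx : 0 < x) (hy : 0 < y) :
    Pxyy K Rd Rf x y = scaledDensity K Rd Rf x y *
      (logDerivY K Rd Rf x y / 2 * (1 / 2 - fhat K Rd Rf x * y⁻¹)
        + fhat K Rd Rf x / 2 * y⁻¹ ^ 2) := by
  have h : (fun u => iteratedDeriv 2 (fun v => PutBS K Rd Rf u v) y) =ᶠ[nhds x]
      fun u => u / 2 * (scaledDensity K Rd Rf u y * logDerivY K Rd Rf u y) := by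
    filter_upwards [Ioi_mem_nhds hx] with u hu
    exact iteratedDeriv_two_putBS_snd hK hu hy
  rw [Pxyy, h.deriv_eq]
  refine (((hasDerivAt_id x).div_const 2).mul ((hasDerivAt_scaledDensity_fst hK hx hy).mul
    (hasDerivAt_logDerivY_fst hK hx))).deriv.trans ?_
  simp only [id, Pi.mul_apply]
  field_simp
  ring

lemma Pyyy_eq (hK : 0 < K) (hx : 0 < x) (hy : 0 < y) :
    Pyyy K Rd Rf x y = scaledDensity K Rd Rf x y *
      (x / 2 * (logDerivY K Rd Rf x y ^ 2
        + (-fhat K Rd Rf x ^ 2 * y⁻¹ ^ 3 + 1 / 2 * y⁻¹ ^ 2))) := by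
  rw [Pyyy, iteratedDeriv_succ]
  have h : iteratedDeriv 2 (fun v => PutBS K Rd Rf x v) =ᶠ[nhds y]
      fun v => x / 2 * (scaledDensity K Rd Rf x v * logDerivY K Rd Rf x v) := by
    filter_upwards [Ioi_mem_nhds hy] with v hv
    exact iteratedDeriv_two_putBS_snd hK hx hv
  rw [h.deriv_eq]
  refine (((hasDerivAt_scaledDensity_snd hy).mul
    (hasDerivAt_logDerivY_snd hy)).const_mul (x / 2)).deriv.trans ?_
  ring

lemma scaledDensity_eq (hy : 0 < y) :
    scaledDensity K Rd Rf x y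
      = Real.exp (-Rf) * (√(2 * π))⁻¹ * Real.exp (-fhat K Rd Rf x / 2) *
        (y⁻¹ ^ (1 / 2 : ℝ) * Real.exp (-(fhat K Rd Rf x ^ 2 / 2) * y⁻¹) *
          Real.exp (-y / 8)) := by
  have h : Real.exp (-dplus K Rd Rf x y ^ 2 / 2) = Real.exp (-fhat K Rd Rf x / 2) *
      Real.exp (-(fhat K Rd Rf x ^ 2 / 2) * y⁻¹) * Real.exp (-y / 8) := by
    rw [← Real.exp_add, ← Real.exp_add, dplus_sq hy]
    congr 1
    ring
  rw [scaledDensity, stdNormalPDF, h, ← Real.sqrt_eq_rpow, Real.sqrt_inv]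
  ring

lemma tendsto_scaledDensity_mul_inv_pow_zero (hf : fhat K Rd Rf x ≠ 0) (n : ℕ) :
    Tendsto (fun y => scaledDensity K Rd Rf x y * y⁻¹ ^ n)
      (nhdsWithin 0 (Set.Ioi 0)) (nhds 0) := by
  have hexp : Tendsto (fun y : ℝ => Real.exp (-y / 8)) (nhdsWithin 0 (Set.Ioi 0)) (nhds 1) := by
    have : Continuous fun y : ℝ => Real.exp (-y / 8) := by fun_prop
    simpa using (this.tendsto 0).mono_left nhdsWithin_le_nhds
  have hmain := (tendsto_rpow_mul_exp_neg_mul_atTop_nhds_zero (1 / 2 + n)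
    (fhat K Rd Rf x ^ 2 / 2) (by positivity)).comp (tendsto_inv_nhdsGT_zero (𝕜 := ℝ))
  have h := (hmain.mul hexp).const_mul
    (Real.exp (-Rf) * (√(2 * π))⁻¹ * Real.exp (-fhat K Rd Rf x / 2))
  rw [zero_mul, mul_zero] at h
  refine h.congr' ?_
  filter_upwards [self_mem_nhdsWithin] with y hy
  have hy : 0 < y := hy
  rw [scaledDensity_eq hy]
  simp only [Function.comp]
  rw [Real.rpow_add (inv_pos.2 hy), Real.rpow_natCast]
  ring

lemma tendsto_scaledDensity_mul_inv_pow_atTop (n : ℕ) :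
    Tendsto (fun y => scaledDensity K Rd Rf x y * y⁻¹ ^ n) atTop (nhds 0) := by
  have hinv : Tendsto (fun y : ℝ => y⁻¹) atTop (nhds 0) := tendsto_inv_atTop_zero
  have hexp : Tendsto (fun y : ℝ => Real.exp (-y / 8)) atTop (nhds 0) :=
    Real.tendsto_exp_atBot.comp (tendsto_neg_atTop_atBot.atBot_div_const (by norm_num))
  have hcont : Continuous fun t : ℝ =>
      t ^ (1 / 2 : ℝ) * Real.exp (-(fhat K Rd Rf x ^ 2 / 2) * t) * t ^ n :=
    ((Real.continuous_rpow_const (by norm_num)).mul (by fun_prop)).mul (by fun_prop)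
  have h := (((hcont.tendsto 0).comp hinv).mul hexp).const_mul
    (Real.exp (-Rf) * (√(2 * π))⁻¹ * Real.exp (-fhat K Rd Rf x / 2))
  rw [mul_zero, mul_zero] at h
  refine h.congr' ?_
  filter_upwards [eventually_gt_atTop 0] with y hy
  rw [scaledDensity_eq hy]
  simp only [Function.comp]
  ring

end

lemma tendsto_mul_polynomial_eval_zero {g t : ℝ → ℝ} {l : Filter ℝ}
    (h : ∀ n : ℕ, Tendsto (fun y => g y * t y ^ n) l (nhds 0)) (p : Polynomial ℝ) :
    Tendsto (fun y => g y * p.eval (t y)) l (nhds 0) := by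
  have hsum : Tendsto (fun y => ∑ i ∈ Finset.range (p.natDegree + 1),
      p.coeff i * (g y * t y ^ i)) l (nhds 0) := by
    simpa using tendsto_finsetSum _ fun i _ => (h i).const_mul (p.coeff i)
  refine hsum.congr fun y => ?_
  rw [Polynomial.eval_eq_sum_range, Finset.mul_sum]
  exact Finset.sum_congr rfl fun i _ => by ring

open Polynomial in
lemma third_partials_tendsto_zero {K Rd Rf x : ℝ} (hK : 0 < K) (hx : 0 < x) {l : Filter ℝ}
    (hl : ∀ᶠ y in l, 0 < y)
    (h : ∀ n : ℕ, Tendsto (fun y => scaledDensity K Rd Rf x y * y⁻¹ ^ n) l (nhds 0)) :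
    Tendsto (fun y => Pxxx K Rd Rf x y) l (nhds 0) ∧
    Tendsto (fun y => Pxxy K Rd Rf x y) l (nhds 0) ∧
    Tendsto (fun y => Pxyy K Rd Rf x y) l (nhds 0) ∧
    Tendsto (fun y => Pyyy K Rd Rf x y) l (nhds 0) := by
  set f := fhat K Rd Rf x with hfdef
  let q : ℝ[X] := C (f ^ 2 / 2) * X ^ 2 - C (1 / 2) * X - C (1 / 8)
  have hq : ∀ y, q.eval y⁻¹ = logDerivY K Rd Rf x y := fun y => by
    simp only [q, logDerivY, eval_sub, eval_mul, eval_C, eval_pow, eval_X, hfdef]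
  refine ⟨(tendsto_mul_polynomial_eval_zero h
      (C (-1 / x ^ 2) * (C f * X + C (3 / 2)))).congr' ?_,
    (tendsto_mul_polynomial_eval_zero h (q * C x⁻¹)).congr' ?_,
    (tendsto_mul_polynomial_eval_zero h
      (q * C (1 / 2) * (C (1 / 2) - C f * X) + C (f / 2) * X ^ 2)).congr' ?_,
    (tendsto_mul_polynomial_eval_zero h
      (C (x / 2) * (q ^ 2 + (C (-f ^ 2) * X ^ 3 + C (1 / 2) * X ^ 2)))).congr' ?_⟩
  all_goals filter_upwards [hl] with y hy
  · rw [Pxxx_eq hK hx hy]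
    simp only [eval_add, eval_mul, eval_C, eval_X]
    ring
  · rw [Pxxy_eq hK hx hy]
    simp only [eval_mul, eval_C, hq]
    ring
  · rw [Pxyy_eq hK hx hy]
    simp only [eval_add, eval_sub, eval_mul, eval_C, eval_X, eval_pow, hq]
    ring
  · rw [Pyyy_eq hK hx hy]
    simp only [eval_add, eval_mul, eval_C, eval_X, eval_pow, hq, hfdef]

/-- For fixed x > 0 with f̂(x) = ln(x/K) + R_d − R_f ≠ 0, each third-order partial derivative
of Put_BS tends to 0 as y → 0⁺ and as y → ∞. -/
theorem putBS_third_partials_vanish_of_fhat_ne_zero (K Rd Rf : ℝ) (hK : 0 < K)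
    (x : ℝ) (hx : 0 < x) (hf : Real.log (x / K) + Rd - Rf ≠ 0) :
    Tendsto (fun y => Pxxx K Rd Rf x y) (nhdsWithin 0 (Set.Ioi 0)) (nhds 0) ∧
    Tendsto (fun y => Pxxx K Rd Rf x y) atTop (nhds 0) ∧
    Tendsto (fun y => Pxxy K Rd Rf x y) (nhdsWithin 0 (Set.Ioi 0)) (nhds 0) ∧
    Tendsto (fun y => Pxxy K Rd Rf x y) atTop (nhds 0) ∧
    Tendsto (fun y => Pxyy K Rd Rf x y) (nhdsWithin 0 (Set.Ioi 0)) (nhds 0) ∧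
    Tendsto (fun y => Pxyy K Rd Rf x y) atTop (nhds 0) ∧
    Tendsto (fun y => Pyyy K Rd Rf x y) (nhdsWithin 0 (Set.Ioi 0)) (nhds 0) ∧
    Tendsto (fun y => Pyyy K Rd Rf x y) atTop (nhds 0) := by
  obtain ⟨h1, h2, h3, h4⟩ := third_partials_tendsto_zero (Rd := Rd) (Rf := Rf) hK hx
    self_mem_nhdsWithin (tendsto_scaledDensity_mul_inv_pow_zero hf)
  obtain ⟨k1, k2, k3, k4⟩ := third_partials_tendsto_zero (Rd := Rd) (Rf := Rf) hK hx
    (eventually_gt_atTop 0) tendsto_scaledDensity_mul_inv_pow_atTop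
  exact ⟨h1, k1, h2, k2, h3, k3, h4, k4⟩
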